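/- Let C₀ ≥ 0 and let a : ℤ → ℂ be any sequence with |a(n)| ≤ C₀|F(n)| for all n ∈ ℤ. Then for every t > 0 and every k ∈ ℂ with 0 ≤ Im k ≤ ε, the series Σ_{n ≥ −N(t)} a(n) e^{ikn} converges absolutely, and e^{−βt} | Σ_{n ≥ −N(t)} a(n) e^{ikn} | ≤ C₀ ‖F‖₁ e^{−(β−β₀)t}. (This is the estimate of Lemma 6.1(i): the analytic part R_{a,t} of the reflection coefficient, multiplied by e^{−βt}, is exponentially small in the strip 0 < Im k < ε.) -/

import Mathlib

open Complex

/-- If `n ≥ -⌊c / ε⌋` and `0 ≤ Im k ≤ ε`, then `|e^{ikn}| ≤ e^c`. -/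
lemma norm_exp_I_mul_intCast_le {ε c : ℝ} (hε : 0 < ε) (hc : 0 ≤ c) {k : ℂ}
    (hk : 0 ≤ k.im) (hkε : k.im ≤ ε) {n : ℤ} (hn : -(⌊c / ε⌋₊ : ℤ) ≤ n) :
    ‖Complex.exp (Complex.I * k * (n : ℂ))‖ ≤ Real.exp c := by
  have hre : (Complex.I * k * (n : ℂ)).re = k.im * -(n : ℝ) := by simp
  have hN : (⌊c / ε⌋₊ : ℝ) ≤ c / ε := Nat.floor_le (by positivity)
  have hn' : -(n : ℝ) ≤ (⌊c / ε⌋₊ : ℝ) := by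
    have : -(⌊c / ε⌋₊ : ℝ) ≤ (n : ℝ) := by exact_mod_cast hn
    linarith
  rw [Complex.norm_exp, hre, Real.exp_le_exp]
  calc k.im * -(n : ℝ) ≤ k.im * (c / ε) := mul_le_mul_of_nonneg_left (hn'.trans hN) hk
    _ ≤ ε * (c / ε) := mul_le_mul_of_nonneg_right hkε (by positivity)
    _ = c := by field_simp

/-- Lemma 6.1(i) of the paper.
Let `F : ℤ → ℂ` be absolutely summable, `ε > 0`, `0 < β₀ < β`, and `N(t) = ⌊β₀ t / ε⌋`.
Let `a : ℤ → ℂ` satisfy `|a(n)| ≤ C₀ |F(n)|`.  Then for every `t > 0` and every `k ∈ ℂ`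
with `0 ≤ Im k ≤ ε` the series `Σ_{n ≥ −N(t)} a(n) e^{ikn}` converges absolutely and
`e^{−βt} |Σ_{n ≥ −N(t)} a(n) e^{ikn}| ≤ C₀ ‖F‖₁ e^{−(β−β₀)t}`. -/
theorem analytic_part_estimate
    (F : ℤ → ℂ) (hF : Summable fun n : ℤ => ‖F n‖)
    (ε β β₀ : ℝ) (hε : 0 < ε) (hβ₀ : 0 < β₀) (hβ₀β : β₀ < β)
    (C₀ : ℝ) (hC₀ : 0 ≤ C₀)
    (a : ℤ → ℂ) (ha : ∀ n : ℤ, ‖a n‖ ≤ C₀ * ‖F n‖) :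
    ∀ t : ℝ, 0 < t → ∀ k : ℂ, 0 ≤ k.im → k.im ≤ ε →
      Summable (fun n : {n : ℤ // -(⌊β₀ * t / ε⌋₊ : ℤ) ≤ n} =>
        ‖a n.1 * Complex.exp (Complex.I * k * (n.1 : ℂ))‖) ∧
      Real.exp (-β * t) *
          ‖∑' n : {n : ℤ // -(⌊β₀ * t / ε⌋₊ : ℤ) ≤ n},
            a n.1 * Complex.exp (Complex.I * k * (n.1 : ℂ))‖ ≤
        C₀ * (∑' n : ℤ, ‖F n‖) * Real.exp (-(β - β₀) * t) := by
  intro t ht k hk hkε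
  have hterm : ∀ n : {n : ℤ // -(⌊β₀ * t / ε⌋₊ : ℤ) ≤ n},
      ‖a n.1 * Complex.exp (Complex.I * k * (n.1 : ℂ))‖ ≤
        C₀ * Real.exp (β₀ * t) * ‖F n.1‖ := fun n => by
    rw [norm_mul, mul_right_comm C₀]
    exact mul_le_mul (ha n.1) (norm_exp_I_mul_intCast_le hε (by positivity) hk hkε n.2)
      (norm_nonneg _) (by positivity)
  have hFsub : Summable fun n : {n : ℤ // -(⌊β₀ * t / ε⌋₊ : ℤ) ≤ n} => ‖F n.1‖ :=
    hF.comp_injective Subtype.val_injective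
  refine ⟨(hFsub.mul_left _).of_nonneg_of_le (fun _ => norm_nonneg _) hterm, ?_⟩
  have hFle : ∑' n : {n : ℤ // -(⌊β₀ * t / ε⌋₊ : ℤ) ≤ n}, ‖F n.1‖ ≤ ∑' n : ℤ, ‖F n‖ :=
    hF.tsum_subtype_le _ {n : ℤ | -(⌊β₀ * t / ε⌋₊ : ℤ) ≤ n} fun _ => norm_nonneg _
  have hexp : Real.exp (-(β - β₀) * t) = Real.exp (-β * t) * Real.exp (β₀ * t) := by
    rw [← Real.exp_add]
    ring_nf
  calc _ ≤ Real.exp (-β * t) * (C₀ * Real.exp (β₀ * t) *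
        ∑' n : {n : ℤ // -(⌊β₀ * t / ε⌋₊ : ℤ) ≤ n}, ‖F n.1‖) := by
        gcongr
        exact tsum_of_norm_bounded (hFsub.hasSum.mul_left _) hterm
    _ ≤ Real.exp (-β * t) * (C₀ * Real.exp (β₀ * t) * ∑' n : ℤ, ‖F n‖) := by gcongr
    _ = _ := by
        rw [hexp]
        ring
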